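/- Let p and q be probability vectors on [N], let a ∈ [N] with 0 < p_a < 1, let κ be a positive integer, and let γ be any coupling of the product measures p^κ and q^κ, i.e. a probability measure on [N]^κ × [N]^κ whose first marginal is p^κ and whose second marginal is q^κ. Let (X̃, Ỹ) have the law of γ conditioned on the event {(x, y) : x ≠ a^κ}, where a^κ = (a, …, a) ∈ [N]^κ. Then H(X̃) − H(Ỹ) ≥ κ(H(p) − H(q)) − 2Φ(p_a^κ) − κ p_a^κ log N. -/

import Mathlib

open MeasureTheory ProbabilityTheory

/-- Shannon entropy of a probability vector. -/
noncomputable def shannonH {N : ℕ} (p : Fin N → ℝ) : ℝ :=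
  -∑ i, p i * Real.log (p i)

/-- Shannon entropy of a (discrete) measure on a finite type. -/
noncomputable def entropyOf {E : Type*} [Fintype E] [MeasurableSpace E] (μ : Measure E) : ℝ :=
  -∑ e, (μ {e}).toReal * Real.log ((μ {e}).toReal)

/-- The binary entropy function `Φ(t) = -t log t - (1-t) log (1-t)`. -/
noncomputable def PhiEnt (t : ℝ) : ℝ := -(t * Real.log t) - (1 - t) * Real.log (1 - t)

/-- The purely atomic measure on `Fin N` with weights `p`. -/
noncomputable def discMeasure {N : ℕ} (p : Fin N → ℝ) : Measure (Fin N) :=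
  ∑ i, ENNReal.ofReal (p i) • Measure.dirac i

lemma entropyOf_eq_sum_negMulLog {E : Type*} [Fintype E] [MeasurableSpace E] (μ : Measure E) :
    entropyOf μ = ∑ e, Real.negMulLog (μ.real {e}) := by
  simp [entropyOf, Real.negMulLog, Measure.real]

lemma entropyOf_nonneg {E : Type*} [Fintype E] [MeasurableSpace E] (μ : Measure E)
    [IsProbabilityMeasure μ] : 0 ≤ entropyOf μ := by
  rw [entropyOf_eq_sum_negMulLog]
  exact Finset.sum_nonneg fun e _ => Real.negMulLog_nonneg measureReal_nonneg measureReal_le_one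

lemma sum_measureReal_singleton_univ {E : Type*} [Fintype E] [MeasurableSpace E]
    [MeasurableSingletonClass E] (μ : Measure E) [IsProbabilityMeasure μ] :
    ∑ e, μ.real {e} = 1 := by
  simp

lemma entropyOf_le_log_card {E : Type*} [Fintype E] [Nonempty E] [MeasurableSpace E]
    [MeasurableSingletonClass E] (μ : Measure E) [IsProbabilityMeasure μ] :
    entropyOf μ ≤ Real.log (Fintype.card E) := by
  have hn : (0 : ℝ) < Fintype.card E := by exact_mod_cast Fintype.card_pos
  have h := Real.concaveOn_negMulLog.le_map_sum (t := Finset.univ)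
    (w := fun _ : E => (Fintype.card E : ℝ)⁻¹) (p := fun e => μ.real {e})
    (fun _ _ => by positivity) (by simp [hn.ne']) (fun _ _ => measureReal_nonneg)
  simp only [smul_eq_mul, ← Finset.mul_sum, sum_measureReal_singleton_univ, mul_one,
    ← entropyOf_eq_sum_negMulLog] at h
  rw [Real.negMulLog, Real.log_inv, neg_mul_neg] at h
  exact le_of_mul_le_mul_left h (inv_pos.2 hn)

lemma discMeasure_singleton {N : ℕ} (p : Fin N → ℝ) (i : Fin N) :
    discMeasure p {i} = ENNReal.ofReal (p i) := by
  simp [discMeasure, Set.indicator_apply]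

instance {N : ℕ} (p : Fin N → ℝ) : IsFiniteMeasure (discMeasure p) :=
  ⟨by simp [discMeasure]⟩

lemma pi_discMeasure_real_singleton {N κ : ℕ} {p : Fin N → ℝ} (hp : ∀ i, 0 ≤ p i)
    (x : Fin κ → Fin N) :
    (Measure.pi fun _ : Fin κ => discMeasure p).real {x} = ∏ i, p (x i) := by
  simp [Measure.real, Measure.pi_singleton, discMeasure_singleton, ENNReal.toReal_prod, hp]

lemma entropyOf_pi_discMeasure {N : ℕ} {p : Fin N → ℝ} (hp0 : ∀ i, 0 ≤ p i)
    (hp1 : ∑ i, p i = 1) (κ : ℕ) :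
    entropyOf (Measure.pi fun _ : Fin κ => discMeasure p) = κ * shannonH p := by
  have hterm (x : Fin κ → Fin N) : Real.negMulLog (∏ i, p (x i)) =
      -∑ i, ∏ j, (if j = i then p (x j) * Real.log (p (x j)) else p (x j)) := by
    have hprod (i : Fin κ) :
        ∏ j, (if j = i then p (x j) * Real.log (p (x j)) else p (x j)) =
          (∏ j, p (x j)) * Real.log (p (x i)) := by
      have (j : Fin κ) : (if j = i then p (x j) * Real.log (p (x j)) else p (x j)) =
          p (x j) * (if j = i then Real.log (p (x j)) else 1) := by
        split_ifs <;> simp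
      simp_rw [this, Finset.prod_mul_distrib]
      simp
    simp_rw [hprod, ← Finset.mul_sum]
    by_cases h : ∏ i, p (x i) = 0
    · simp [h]
    · rw [Real.negMulLog, Real.log_prod (fun i _ => (Finset.prod_ne_zero_iff.1 h) i
        (Finset.mem_univ i)), neg_mul]
  have hmarg (i : Fin κ) :
      ∑ x : Fin κ → Fin N, ∏ j, (if j = i then p (x j) * Real.log (p (x j)) else p (x j)) =
        ∑ v, p v * Real.log (p v) := by
    rw [← Fintype.prod_sum
      fun j v => if j = i then p v * Real.log (p v) else p v]
    rw [Finset.prod_eq_single i]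
    · simp
    · intro j _ hj
      simp [hj, hp1]
    · simp
  rw [entropyOf_eq_sum_negMulLog]
  simp_rw [pi_discMeasure_real_singleton hp0, hterm]
  rw [Finset.sum_neg_distrib, Finset.sum_comm]
  simp [hmarg, shannonH]

/-- Chain rule for conditioning on the complement of an atom. -/
lemma entropyOf_eq_of_remove_atom {E : Type*} [Fintype E] [MeasurableSpace E]
    [DecidableEq E] [MeasurableSingletonClass E] (μ ν : Measure E) [IsProbabilityMeasure ν] (b : E)
    (hν : ∀ x, (1 - μ.real {b}) * ν.real {x} = if x = b then 0 else μ.real {x}) :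
    entropyOf μ = PhiEnt (μ.real {b}) + (1 - μ.real {b}) * entropyOf ν := by
  have hterm (x : E) : Real.negMulLog (μ.real {x}) =
      (if x = b then Real.negMulLog (μ.real {b}) else 0) +
        (ν.real {x} * Real.negMulLog (1 - μ.real {b}) +
          (1 - μ.real {b}) * Real.negMulLog (ν.real {x})) := by
    rw [← Real.negMulLog_mul, hν]
    split_ifs with h
    · simp only [h, Real.negMulLog_zero, add_zero]
    · rw [zero_add]
  rw [entropyOf_eq_sum_negMulLog, entropyOf_eq_sum_negMulLog,
    Finset.sum_congr rfl fun x _ => hterm x, Finset.sum_add_distrib,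
    Finset.sum_add_distrib, ← Finset.sum_mul, ← Finset.mul_sum,
    sum_measureReal_singleton_univ]
  simp [PhiEnt, Real.negMulLog]
  ring

/-- Concavity of entropy, keeping only one component of the mixture. -/
lemma mul_entropyOf_le {E : Type*} [Fintype E] [MeasurableSpace E]
    (μ ν : Measure E) {t : ℝ} (ht0 : 0 < t) (ht1 : t ≤ 1)
    (hlow : ∀ x, (1 - t) * ν.real {x} ≤ μ.real {x})
    (hupp : ∀ x, μ.real {x} ≤ (1 - t) * ν.real {x} + t) :
    (1 - t) * entropyOf ν ≤ entropyOf μ := by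
  rw [entropyOf_eq_sum_negMulLog, entropyOf_eq_sum_negMulLog, Finset.mul_sum]
  refine Finset.sum_le_sum fun x _ => ?_
  set r := (μ.real {x} - (1 - t) * ν.real {x}) / t with hr
  have hr0 : 0 ≤ r := div_nonneg (sub_nonneg.2 (hlow x)) ht0.le
  have hr1 : r ≤ 1 := by
    rw [hr, div_le_one ht0]
    linarith [hupp x]
  have hmix : (1 - t) * ν.real {x} + t * r = μ.real {x} := by
    rw [hr]
    field_simp
    ring
  have h := Real.concaveOn_negMulLog.2 (x := ν.real {x}) (y := r) measureReal_nonneg hr0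
    (sub_nonneg.2 ht1) ht0.le (sub_add_cancel 1 t)
  simp only [smul_eq_mul, hmix] at h
  linarith [mul_nonneg ht0.le (Real.negMulLog_nonneg hr0 hr1)]

lemma PhiEnt_nonneg {t : ℝ} (ht0 : 0 ≤ t) (ht1 : t ≤ 1) : 0 ≤ PhiEnt t := by
  have h := Real.negMulLog_nonneg ht0 ht1
  have h' := Real.negMulLog_nonneg (sub_nonneg.2 ht1) (sub_le_self 1 ht0)
  simp only [Real.negMulLog] at h h'
  simp only [PhiEnt]
  linarith

/-- The entropy gap estimate: if `γ` couples `p^κ` and `q^κ` and `(X̃, Ỹ)` has the law of `γ`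
conditioned on `{x ≠ a^κ}`, then `H(X̃) - H(Ỹ) ≥ κ(H(p) - H(q)) - 2Φ(p_a^κ) - κ p_a^κ log N`. -/
theorem entropy_gap_conditioned {N : ℕ} (p q : Fin N → ℝ)
    (hp0 : ∀ i, 0 ≤ p i) (hp1 : ∑ i, p i = 1)
    (hq0 : ∀ i, 0 ≤ q i) (hq1 : ∑ i, q i = 1)
    (a : Fin N) (hpa0 : 0 < p a) (hpa1 : p a < 1)
    (κ : ℕ) (hκ : 0 < κ)
    (γ : Measure ((Fin κ → Fin N) × (Fin κ → Fin N))) (hγ : IsProbabilityMeasure γ)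
    (hγ1 : γ.map Prod.fst = Measure.pi fun _ : Fin κ => discMeasure p)
    (hγ2 : γ.map Prod.snd = Measure.pi fun _ : Fin κ => discMeasure q)
    (Γ : Measure ((Fin κ → Fin N) × (Fin κ → Fin N)))
    (hΓ : Γ = γ[|{z | z.1 ≠ fun _ => a}]) :
    entropyOf (Γ.map Prod.fst) - entropyOf (Γ.map Prod.snd) ≥
      κ * (shannonH p - shannonH q) - 2 * PhiEnt (p a ^ κ) - κ * p a ^ κ * Real.log N := by
  classical
  set b : Fin κ → Fin N := fun _ => a with hb
  set t := p a ^ κ with ht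
  have ht0 : 0 < t := pow_pos hpa0 κ
  have ht1 : t < 1 := pow_lt_one₀ hpa0.le hpa1 hκ.ne'
  have hX (x : Fin κ → Fin N) : γ.real (Prod.fst ⁻¹' {x}) =
      (Measure.pi fun _ : Fin κ => discMeasure p).real {x} := by
    rw [← hγ1, map_measureReal_apply measurable_fst (measurableSet_singleton x)]
  have hY (y : Fin κ → Fin N) : γ.real (Prod.snd ⁻¹' {y}) =
      (Measure.pi fun _ : Fin κ => discMeasure q).real {y} := by
    rw [← hγ2, map_measureReal_apply measurable_snd (measurableSet_singleton y)]
  have hPb : (Measure.pi fun _ : Fin κ => discMeasure p).real {b} = t := by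
    simp [pi_discMeasure_real_singleton hp0, hb, ht]
  set S : Set ((Fin κ → Fin N) × (Fin κ → Fin N)) := {z | z.1 ≠ b} with hS
  have hSm : MeasurableSet S := S.toFinite.measurableSet
  have hSc : Sᶜ = Prod.fst ⁻¹' {b} := by
    ext z
    simp [hS]
  have hSct : γ.real Sᶜ = t := by rw [hSc, hX, hPb]
  have hSt : γ.real S = 1 - t := by
    linarith [probReal_add_probReal_compl (μ := γ) hSm]
  have hS0 : γ S ≠ 0 := by
    intro h
    simp only [Measure.real, h, ENNReal.toReal_zero] at hSt
    linarith
  have hΓp : IsProbabilityMeasure Γ := hΓ ▸ cond_isProbabilityMeasure hS0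
  have hΓX : IsProbabilityMeasure (Γ.map Prod.fst) :=
    Measure.isProbabilityMeasure_map measurable_fst.aemeasurable
  have hΓY : IsProbabilityMeasure (Γ.map Prod.snd) :=
    Measure.isProbabilityMeasure_map measurable_snd.aemeasurable
  have hcond (T : Set ((Fin κ → Fin N) × (Fin κ → Fin N))) :
      (1 - t) * Γ.real T = γ.real (S ∩ T) := by
    rw [hΓ, Measure.real, cond_apply hSm, ENNReal.toReal_mul, ENNReal.toReal_inv,
      ← Measure.real, ← Measure.real, hSt, mul_inv_cancel_left₀ (by linarith)]
  have hchain := entropyOf_eq_of_remove_atom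
    (Measure.pi fun _ : Fin κ => discMeasure p) (Γ.map Prod.fst) b (fun x => by
      rw [hPb, map_measureReal_apply measurable_fst (measurableSet_singleton x), hcond, ← hX]
      split_ifs with h
      · rw [h, ← hSc, Set.inter_compl_self, measureReal_empty]
      · congr 1
        refine Set.inter_eq_right.2 fun z hz => ?_
        simpa [hS, Set.mem_singleton_iff.1 hz] using h)
  have hsplit (y : Fin κ → Fin N) : (1 - t) * (Γ.map Prod.snd).real {y} +
      γ.real (Sᶜ ∩ Prod.snd ⁻¹' {y}) =
        (Measure.pi fun _ : Fin κ => discMeasure q).real {y} := by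
    rw [map_measureReal_apply measurable_snd (measurableSet_singleton y), hcond, ← hY,
      Set.inter_comm S, Set.inter_comm Sᶜ, ← Set.sdiff_eq]
    exact measureReal_inter_add_sdiff hSm
  have hconc := mul_entropyOf_le (Measure.pi fun _ : Fin κ => discMeasure q) (Γ.map Prod.snd)
    ht0 ht1.le
    (fun y => by linarith [hsplit y, measureReal_nonneg (μ := γ) (s := Sᶜ ∩ Prod.snd ⁻¹' {y})])
    (fun y => by
      have : γ.real (Sᶜ ∩ Prod.snd ⁻¹' {y}) ≤ γ.real Sᶜ := measureReal_mono Set.inter_subset_left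
      linarith [hsplit y])
  rw [hPb, entropyOf_pi_discMeasure hp0 hp1] at hchain
  rw [entropyOf_pi_discMeasure hq0 hq1] at hconc
  have : Nonempty (Fin κ → Fin N) := ⟨b⟩
  have hlog := entropyOf_le_log_card (Γ.map Prod.snd)
  simp only [Fintype.card_pi, Fintype.card_fin, Finset.prod_const, Finset.card_univ, Nat.cast_pow,
    Real.log_pow] at hlog
  have hlow := mul_nonneg ht0.le (entropyOf_nonneg (Γ.map Prod.fst))
  have hupp := mul_le_mul_of_nonneg_left hlog ht0.le
  linarith [PhiEnt_nonneg ht0.le ht1.le]
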